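/- Let H(r) and h(r) be two nonnegative continuous functions on the interval (0,1] and let t ∈ (0, 1/4). Assume that for every r ∈ [δ, 1/2]: max_{r ≤ s ≤ 2r} H(s) ≤ C₀ H(2r) and max_{r ≤ s, s′ ≤ 2r} |h(s) − h(s′)| ≤ C₀ H(2r); and also H(t r) ≤ (1/2) H(r) + C₀ ω(δ/r) { H(2r) + h(2r) }, where ω is a nonnegative increasing function on [0,1] with ω(0) = 0 and ∫₀¹ ω(s)/s ds < ∞. Then max_{δ ≤ r ≤ 1} { H(r) + h(r) } ≤ C { H(1) + h(1) }, where C depends only on C₀, t and ω. -/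

import Mathlib

open MeasureTheory Set

/-- If `H` is controlled and `h` has controlled oscillation on dyadic scales down to `δ`, then
the values at `r` are controlled by those at a larger radius `ρ` comparable to `r`. -/
theorem dyadic_chain_bound {C₀ δ : ℝ} {H h : ℝ → ℝ} (hC₀ : 0 < C₀) (hδ : 0 < δ)
    (hpos : ∀ r ∈ Ioc (0 : ℝ) 1, 0 ≤ H r)
    (hH : ∀ r, δ ≤ r → r ≤ 1 / 2 → ∀ s, r ≤ s → s ≤ 2 * r → H s ≤ C₀ * H (2 * r))
    (hh : ∀ r, δ ≤ r → r ≤ 1 / 2 → ∀ s s', r ≤ s → s ≤ 2 * r → r ≤ s' → s' ≤ 2 * r →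
      |h s - h s'| ≤ C₀ * H (2 * r))
    {ρ : ℝ} (hρδ : 2 * δ ≤ ρ) (hρ : ρ ≤ 1) (m : ℕ) {r : ℝ} (hr : δ ≤ r) (hrρ : r ≤ ρ)
    (hm : ρ ≤ 2 ^ m * r) :
    H r ≤ (1 + C₀) ^ m * H ρ ∧ |h r - h ρ| ≤ ((1 + C₀) ^ m - 1) * H ρ := by
  have hHρ : 0 ≤ H ρ := hpos ρ ⟨by linarith, hρ⟩
  induction m generalizing r with
  | zero =>
    obtain rfl : r = ρ := le_antisymm hrρ (by simpa using hm)
    simp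
  | succ m ih =>
    have hpow : 1 ≤ (1 + C₀) ^ m := one_le_pow₀ (by linarith)
    have hprod := mul_le_mul_of_nonneg_right hpow hHρ
    have hprod' := mul_le_mul_of_nonneg_left hprod hC₀.le
    rw [pow_succ]
    rcases le_total ρ (2 * r) with hle | hle
    · have h1 := hH (ρ / 2) (by linarith) (by linarith) r (by linarith) (by linarith)
      have h2 := hh (ρ / 2) (by linarith) (by linarith) r ρ (by linarith) (by linarith)
        (by linarith) (by linarith)
      rw [mul_div_cancel₀ ρ two_ne_zero] at h1 h2
      constructor <;> linarith
    · obtain ⟨i1, i2⟩ := ih (r := 2 * r) (by linarith) hle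
        (hm.trans_eq (by ring))
      have h1 := hH r hr (by linarith) r le_rfl (by linarith)
      have h2 := hh r hr (by linarith) r (2 * r) le_rfl (by linarith) (by linarith) le_rfl
      have h3 := mul_le_mul_of_nonneg_left i1 hC₀.le
      have h4 := abs_sub_le (h r) (h (2 * r)) (h ρ)
      constructor <;> linarith

/-- For a monotone `ω`, the integral of `ω s / s` over `(u, u / t]` dominates `(1 - t) ω u`. -/
theorem mul_le_setIntegral_div_sub {ω : ℝ → ℝ} {t u : ℝ} (ht0 : 0 < t) (ht : t < 1)
    (hωnn : ∀ s ∈ Icc (0 : ℝ) 1, 0 ≤ ω s) (hωmono : MonotoneOn ω (Icc (0 : ℝ) 1))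
    (hωdini : IntegrableOn (fun s => ω s / s) (Ioc (0 : ℝ) 1)) (hu : 0 < u) (hut : u / t ≤ 1) :
    (1 - t) * ω u ≤ (∫ s in Ioc 0 (u / t), ω s / s) - ∫ s in Ioc 0 u, ω s / s := by
  have huv : u ≤ u / t := by rw [le_div_iff₀ ht0]; nlinarith
  have hint : IntegrableOn (fun s => ω s / s) (Ioc u (u / t)) :=
    hωdini.mono_set (Ioc_subset_Ioc hu.le hut)
  have hsplit : (∫ s in Ioc 0 (u / t), ω s / s)
      = (∫ s in Ioc 0 u, ω s / s) + ∫ s in Ioc u (u / t), ω s / s := by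
    rw [← Ioc_union_Ioc_eq_Ioc hu.le huv]
    exact setIntegral_union (Ioc_disjoint_Ioc_of_le le_rfl) measurableSet_Ioc
      (hωdini.mono_set (Ioc_subset_Ioc le_rfl (huv.trans hut))) hint
  have hlow : ∫ _ in Ioc u (u / t), ω u / (u / t) ≤ ∫ s in Ioc u (u / t), ω s / s := by
    refine setIntegral_mono_on (integrableOn_const (by simp)) hint measurableSet_Ioc ?_
    intro s hs
    have hs0 : 0 < s := hu.trans hs.1
    have hs1 : s ≤ 1 := hs.2.trans hut
    exact div_le_div₀ (hωnn s ⟨hs0.le, hs1⟩)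
      (hωmono ⟨hu.le, huv.trans hut⟩ ⟨hs0.le, hs1⟩ hs.1.le) hs0 hs.2
  rw [setIntegral_const, measureReal_def, Real.volume_Ioc, ENNReal.toReal_ofReal (by linarith),
    smul_eq_mul] at hlow
  have heq : (u / t - u) * (ω u / (u / t)) = (1 - t) * ω u := by field_simp
  linarith

/-- The abstract iteration lemma (Lemma 6.3 / `liple4` of the paper, quoted from
Shen's book): if `H` is controlled on dyadic scales, `h` has controlled
oscillation, and a one-step improvement `H(tr) ≤ (1/2)H(r) + C₀ω(δ/r)(H(2r)+h(2r))`
holds with a Dini modulus `ω`, then `max_{δ ≤ r ≤ 1} (H(r) + h(r)) ≤ C (H(1) + h(1))`,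
with `C` depending only on `C₀`, `t` and `ω`. -/
theorem iteration_lemma
    (t C₀ : ℝ) (ht0 : 0 < t) (ht : t < 1 / 4) (hC₀ : 0 < C₀)
    (ω : ℝ → ℝ)
    (hω0 : ω 0 = 0)
    (hωnn : ∀ s ∈ Icc (0 : ℝ) 1, 0 ≤ ω s)
    (hωmono : MonotoneOn ω (Icc (0 : ℝ) 1))
    -- the Dini condition `∫₀¹ ω(s)/s ds < ∞`
    (hωdini : IntegrableOn (fun s => ω s / s) (Ioc (0 : ℝ) 1)) :
    ∃ C : ℝ, 0 < C ∧
      ∀ δ : ℝ, 0 < δ → δ ≤ 1 / 2 →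
        ∀ H h : ℝ → ℝ,
          ContinuousOn H (Ioc (0 : ℝ) 1) → ContinuousOn h (Ioc (0 : ℝ) 1) →
          (∀ r ∈ Ioc (0 : ℝ) 1, 0 ≤ H r ∧ 0 ≤ h r) →
          -- `max_{r ≤ s ≤ 2r} H(s) ≤ C₀ H(2r)`
          (∀ r, δ ≤ r → r ≤ 1 / 2 →
            ∀ s, r ≤ s → s ≤ 2 * r → H s ≤ C₀ * H (2 * r)) →
          -- `max_{r ≤ s, s' ≤ 2r} |h(s) - h(s')| ≤ C₀ H(2r)`
          (∀ r, δ ≤ r → r ≤ 1 / 2 →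
            ∀ s s', r ≤ s → s ≤ 2 * r → r ≤ s' → s' ≤ 2 * r →
              |h s - h s'| ≤ C₀ * H (2 * r)) →
          -- the one-step improvement
          (∀ r, δ ≤ r → r ≤ 1 / 2 →
            H (t * r) ≤ (1 / 2) * H r + C₀ * ω (δ / r) * (H (2 * r) + h (2 * r))) →
          ∀ r, δ ≤ r → r ≤ 1 → H r + h r ≤ C * (H 1 + h 1) := by
  obtain ⟨m, hm⟩ := pow_unbounded_of_one_lt (2 / t) (one_lt_two (α := ℝ))
  rw [div_lt_iff₀ ht0] at hm
  set P : ℝ := (1 + C₀) ^ m with hP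
  have hP1 : 1 ≤ P := one_le_pow₀ (by linarith)
  set β : ℝ := 2 * P * (2 + C₀) with hβ
  have hβP : 2 * P ≤ β := by nlinarith only [hβ, hP1, hC₀]
  have hβ0 : 0 < β := by linarith
  set J : ℝ → ℝ := fun u => ∫ s in Ioc 0 u, ω s / s with hJ
  set K : ℝ := β * C₀ / (1 - t) with hK
  have ht1 : 0 < 1 - t := by linarith
  have hK0 : 0 < K := by positivity
  have hKt : K * (1 - t) = β * C₀ := div_mul_cancel₀ _ ht1.ne'
  have hquot : ∀ s ∈ Ioc (0 : ℝ) 1, 0 ≤ ω s / s := fun s hs =>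
    div_nonneg (hωnn s ⟨hs.1.le, hs.2⟩) hs.1.le
  have hJnn : ∀ u ≤ 1, 0 ≤ J u := fun u hu =>
    setIntegral_nonneg measurableSet_Ioc fun s hs => hquot s ⟨hs.1, hs.2.trans hu⟩
  have hJle : ∀ u ≤ 1, J u ≤ J 1 := fun u hu =>
    setIntegral_mono_set hωdini
      ((ae_restrict_iff' measurableSet_Ioc).2 (Filter.Eventually.of_forall hquot))
      (Ioc_subset_Ioc le_rfl hu).eventuallyLE
  refine ⟨Real.exp (K * J 1) * (2 + C₀ + β * C₀) + (2 * P + 1), by positivity, ?_⟩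
  intro δ hδ hδ2 H h _ _ hpos hH hh hstep r hr hr1
  have hHpos : ∀ r ∈ Ioc (0 : ℝ) 1, 0 ≤ H r := fun r hr => (hpos r hr).1
  obtain ⟨hH1, hh1⟩ := hpos 1 ⟨one_pos, le_rfl⟩
  rcases lt_or_ge (1 / 4) r with hr4 | hr4
  · obtain ⟨c1, c2⟩ := dyadic_chain_bound hC₀ hδ hHpos hH hh (ρ := 1) (by linarith) le_rfl m hr
      hr1 (by nlinarith only [hm, ht, hr4, pow_pos (two_pos (α := ℝ)) m])
    have c3 := (abs_le.1 c2).2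
    have e0 : 0 ≤ Real.exp (K * J 1) * (2 + C₀ + β * C₀) * (H 1 + h 1) := by positivity
    have e1 : 0 ≤ P * h 1 := by positivity
    rw [← hP] at c1 c3
    linarith
  -- The quantity `V` grows by at most the factor `1 + β C₀ ω (δ / x)` from `x` to `t * x`.
  set V : ℝ → ℝ := fun x => h (2 * x) + (1 + C₀) * H (2 * x) + β * H x with hV
  have hVstep : ∀ x, x ≤ 1 / 2 → 2 * δ ≤ t * x →
      V (t * x) ≤ (1 + β * C₀ * ω (δ / x)) * V x := by
    intro x hx hδx
    have hx0 : 0 < x := pos_of_mul_pos_right (by linarith : 0 < t * x) ht0.le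
    have htx : t * x ≤ 1 / 4 * x := mul_le_mul_of_nonneg_right ht.le hx0.le
    have hmx : 2 * x ≤ 2 ^ m * t * x := mul_le_mul_of_nonneg_right hm.le hx0.le
    have hxδ : 2 * δ ≤ x := by linarith
    obtain ⟨p1, p2⟩ := hpos (2 * x) ⟨by linarith, by linarith⟩
    have p3 := hHpos x ⟨hx0, by linarith⟩
    have hωx : 0 ≤ ω (δ / x) := hωnn _ ⟨by positivity, by rw [div_le_one hx0]; linarith⟩
    obtain ⟨c1, c2⟩ := dyadic_chain_bound hC₀ hδ hHpos hH hh hxδ (by linarith) m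
      (r := 2 * (t * x)) (by linarith) (by linarith) (by linarith)
    have c3 := (abs_le.1 c2).2
    have c4 := (abs_le.1 (hh x (by linarith) hx x (2 * x) le_rfl (by linarith) (by linarith)
      le_rfl)).2
    have c5 := mul_le_mul_of_nonneg_left (hstep x (by linarith) hx) hβ0.le
    have c6 := mul_le_mul_of_nonneg_left c1 (by linarith : 0 ≤ 1 + C₀)
    have c7 : 0 ≤ β * C₀ * ω (δ / x) * (C₀ * H (2 * x) + β * H x) := by positivity
    have c8 : β * H x = 2 * P * (2 + C₀) * H x := by rw [hβ]
    simp only [hV]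
    rw [← hP] at c3 c6
    linarith
  have hV0 : V (1 / 2) ≤ (2 + C₀ + β * C₀) * (H 1 + h 1) := by
    have c1 := hH (1 / 2) hδ2 le_rfl (1 / 2) le_rfl (by norm_num)
    have c2 := mul_le_mul_of_nonneg_left c1 hβ0.le
    simp only [hV]
    rw [show (2 : ℝ) * (1 / 2) = 1 by norm_num] at c2 ⊢
    have c3 : 0 ≤ (1 + C₀ + β * C₀) * h 1 := by positivity
    linarith
  have hVnn : ∀ x, 0 < x → x ≤ 1 / 2 → 0 ≤ V x := by
    intro x hx hx2
    obtain ⟨p1, p2⟩ := hpos (2 * x) ⟨by linarith, by linarith⟩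
    have p3 := hHpos x ⟨hx, by linarith⟩
    simp only [hV]
    positivity
  have hiter : ∀ k : ℕ, 2 * δ ≤ t ^ k * (1 / 2) →
      V (t ^ k * (1 / 2)) ≤ Real.exp (K * J (δ / (t ^ k * (1 / 2)))) * V (1 / 2) := by
    intro k
    induction k with
    | zero =>
      intro _
      rw [pow_zero, one_mul]
      refine le_mul_of_one_le_left (hVnn _ (by norm_num) le_rfl) (Real.one_le_exp ?_)
      exact mul_nonneg hK0.le (hJnn _ (by rw [div_le_one (by norm_num)]; exact hδ2))
    | succ k ih =>
      intro hk
      set x : ℝ := t ^ k * (1 / 2) with hx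
      have hx0 : 0 < x := by positivity
      have hx2 : x ≤ 1 / 2 := by
        have := pow_le_one₀ (n := k) ht0.le (by linarith : t ≤ 1)
        linarith
      have hxs : t ^ (k + 1) * (1 / 2) = t * x := by rw [hx]; ring
      rw [hxs] at hk ⊢
      have hu : δ / x / t = δ / (t * x) := by rw [div_div, mul_comm x t]
      have hint := mul_le_setIntegral_div_sub ht0 (by linarith) hωnn hωmono hωdini
        (u := δ / x) (by positivity)
        (by rw [hu, div_le_one (by positivity)]; linarith)
      rw [hu] at hint
      have hfac : 1 + β * C₀ * ω (δ / x) ≤ Real.exp (K * (J (δ / (t * x)) - J (δ / x))) := by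
        refine le_trans ?_ (Real.add_one_le_exp _)
        have := mul_le_mul_of_nonneg_left hint hK0.le
        rw [← mul_assoc, hKt] at this
        linarith
      calc V (t * x) ≤ (1 + β * C₀ * ω (δ / x)) * V x := hVstep x hx2 hk
        _ ≤ Real.exp (K * (J (δ / (t * x)) - J (δ / x))) * V x :=
            mul_le_mul_of_nonneg_right hfac (hVnn x hx0 hx2)
        _ ≤ Real.exp (K * (J (δ / (t * x)) - J (δ / x))) *
              (Real.exp (K * J (δ / x)) * V (1 / 2)) :=
            mul_le_mul_of_nonneg_left (ih (by nlinarith only [hk, hx0, ht])) (Real.exp_pos _).le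
        _ = Real.exp (K * J (δ / (t * x))) * V (1 / 2) := by
            rw [← mul_assoc, ← Real.exp_add]
            congr 2
            ring
  obtain ⟨k, hk1, hk2⟩ := exists_nat_pow_near_of_lt_one (x := 4 * r) (y := t)
    (by linarith) (by linarith) ht0 (by linarith)
  have hk := hiter k (by linarith)
  set x : ℝ := t ^ k * (1 / 2) with hx
  have hx0 : 0 < x := by positivity
  have hx2 : x ≤ 1 / 2 := by
    have := pow_le_one₀ (n := k) ht0.le (by linarith : t ≤ 1)
    linarith
  have htx : t * x < 2 * r := by
    rw [pow_succ] at hk1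
    rw [hx]
    linarith
  have hxr : x ≤ 2 ^ m * r := by
    have : 2 * r ≤ 2 ^ m * t * r := mul_le_mul_of_nonneg_right hm.le (hδ.le.trans hr)
    have : t * x ≤ t * (2 ^ m * r) := by linarith
    exact le_of_mul_le_mul_left this ht0
  obtain ⟨c1, c2⟩ := dyadic_chain_bound hC₀ hδ hHpos hH hh (ρ := x) (by linarith) (by linarith) m
    hr (by linarith) hxr
  have c3 := (abs_le.1 c2).2
  have c4 := (abs_le.1 (hh x (by linarith) hx2 x (2 * x) le_rfl (by linarith) (by linarith)
    le_rfl)).2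
  have p1 := hHpos (2 * x) ⟨by linarith, by linarith⟩
  have p3 := hHpos x ⟨hx0, by linarith⟩
  have hsum : H r + h r ≤ V x := by
    have := mul_le_mul_of_nonneg_right hβP p3
    simp only [hV]
    rw [← hP] at c1 c3
    linarith
  have hexp : Real.exp (K * J (δ / x)) ≤ Real.exp (K * J 1) :=
    Real.exp_le_exp.2 (mul_le_mul_of_nonneg_left
      (hJle _ (by rw [div_le_one hx0]; linarith)) hK0.le)
  have hfin : V x ≤ Real.exp (K * J 1) * (2 + C₀ + β * C₀) * (H 1 + h 1) := by
    rw [mul_assoc]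
    exact hk.trans (mul_le_mul hexp hV0 (hVnn _ (by norm_num) le_rfl) (Real.exp_pos _).le)
  have e0 : 0 ≤ Real.exp (K * J 1) * (2 + C₀ + β * C₀) * (H 1 + h 1) := by positivity
  have e1 : 0 ≤ (2 * P + 1) * (H 1 + h 1) := by positivity
  linarith
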